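/- Let φ: Ω × ℝ → ℝ be jointly measurable with φ(ω,·) convex and finite, and define for a probability measure P and a finite signed measure ν the divergence J(ν|P) := E_P[φ*(·, dν/dP)] if ν ≪ P and +∞ otherwise. Then J is jointly convex: for ν₀, ν₁ finite signed measures, probabilities P₀, P₁, and t ∈ [0,1], J(tν₁ + (1−t)ν₀ | tP₁ + (1−t)P₀) ≤ t·J(ν₁|P₁) + (1−t)·J(ν₀|P₀). -/

import Mathlib

open MeasureTheory Filter Topology

/-- positive part of the conjugate -/
noncomputable def posC {Ω : Type*} (φ : Ω → ℝ → ℝ) (f : Ω → ℝ) (ω : Ω) : ENNReal :=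
  ⨆ x : ℝ, ENNReal.ofReal (x * f ω - φ ω x)

/-- negative part of the conjugate -/
noncomputable def negC {Ω : Type*} (φ : Ω → ℝ → ℝ) (f : Ω → ℝ) (ω : Ω) : ENNReal :=
  ENNReal.ofReal (⨅ x : ℝ, (φ ω x - x * f ω))

lemma ofReal_iInf_aux (g : ℝ → ℝ) :
    ENNReal.ofReal (⨅ x, g x) = ⨅ x, ENNReal.ofReal (g x) := by
  by_cases h : BddBelow (Set.range g)
  · exact Monotone.map_ciInf_of_continuousAt ENNReal.continuous_ofReal.continuousAt
      (fun a b hab => ENNReal.ofReal_le_ofReal hab) h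
  · rw [Real.iInf_of_not_bddBelow h, ENNReal.ofReal_zero]
    symm
    rw [← le_zero_iff]
    have : ∃ x, g x < 0 := by
      by_contra hc
      push Not at hc
      exact h ⟨0, by rintro _ ⟨x, rfl⟩; exact hc x⟩
    obtain ⟨x, hx⟩ := this
    refine (iInf_le _ x).trans ?_
    rw [ENNReal.ofReal_of_nonpos hx.le]

lemma pointwise_aux (ψ : ℝ → ℝ) (y f₁ f₀ : ℝ) (a b : ENNReal) (hab : a + b = 1)
    (hy : y = a.toReal * f₁ + b.toReal * f₀) :
    (⨆ x : ℝ, ENNReal.ofReal (x * y - ψ x))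
      + (a * ENNReal.ofReal (⨅ x : ℝ, (ψ x - x * f₁))
        + b * ENNReal.ofReal (⨅ x : ℝ, (ψ x - x * f₀)))
    ≤ ENNReal.ofReal (⨅ x : ℝ, (ψ x - x * y))
      + (a * (⨆ x : ℝ, ENNReal.ofReal (x * f₁ - ψ x))
        + b * (⨆ x : ℝ, ENNReal.ofReal (x * f₀ - ψ x))) := by
  have ha : a ≠ ⊤ := by rintro rfl; simp at hab
  have hb : b ≠ ⊤ := by rintro rfl; simp at hab
  lift a to NNReal using ha
  lift b to NNReal using hb
  have hab' : (a : ℝ) + b = 1 := by exact_mod_cast hab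
  simp only [ENNReal.coe_toReal] at hy
  have key : ∀ x : ℝ, ENNReal.ofReal (x * y - ψ x)
      + (a * ENNReal.ofReal (ψ x - x * f₁) + b * ENNReal.ofReal (ψ x - x * f₀))
      = ENNReal.ofReal (ψ x - x * y) + (a * ENNReal.ofReal (x * f₁ - ψ x)
        + b * ENNReal.ofReal (x * f₀ - ψ x)) := by
    intro x
    simp only [ENNReal.ofReal]
    norm_cast
    apply NNReal.coe_injective
    push_cast
    simp only [Real.coe_toNNReal']
    have h1 : ∀ u v : ℝ, max (u - v) 0 = max (v - u) 0 + (u - v) := by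
      intro u v
      rcases le_total u v with h | h
      · rw [max_eq_right (by linarith), max_eq_left (by linarith)]; ring
      · rw [max_eq_left (by linarith), max_eq_right (by linarith)]; ring
    rw [h1 (ψ x) (x * f₁), h1 (ψ x) (x * f₀), h1 (x * y) (ψ x), hy]
    have : (b : ℝ) = 1 - a := by linarith
    rw [this]; ring
  have hB : ∀ (f : ℝ) (x : ℝ), ENNReal.ofReal (⨅ x : ℝ, (ψ x - x * f))
      ≤ ENNReal.ofReal (ψ x - x * f) := by
    intro f x; rw [ofReal_iInf_aux]; exact iInf_le _ x
  have hA : ∀ (f : ℝ) (x : ℝ), ENNReal.ofReal (x * f - ψ x) ≤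
      ⨆ x : ℝ, ENNReal.ofReal (x * f - ψ x) :=
    fun f x => le_iSup (fun x : ℝ => ENNReal.ofReal (x * f - ψ x)) x
  rw [ENNReal.iSup_add, ofReal_iInf_aux (fun x => ψ x - x * y), ENNReal.iInf_add]
  refine iSup_le fun x => le_iInf fun x' => ?_
  rcases le_total (x * y - ψ x) 0 with h | h
  · rw [ENNReal.ofReal_of_nonpos h, zero_add]
    calc _ ≤ (a * ENNReal.ofReal (ψ x' - x' * f₁) + b * ENNReal.ofReal (ψ x' - x' * f₀)) := by
          gcongr _ * ?_ + _ * ?_ <;> apply hB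
      _ ≤ _ := le_add_self
      _ = _ := key x'
      _ ≤ _ := by gcongr <;> apply hA
  · calc _ ≤ ENNReal.ofReal (x * y - ψ x)
      + (a * ENNReal.ofReal (ψ x - x * f₁) + b * ENNReal.ofReal (ψ x - x * f₀)) := by
          gcongr _ + (_ * ?_ + _ * ?_) <;> apply hB
      _ = _ := key x
      _ = (a * ENNReal.ofReal (x * f₁ - ψ x)
        + b * ENNReal.ofReal (x * f₀ - ψ x)) := by
          rw [ENNReal.ofReal_of_nonpos (by linarith : ψ x - x * y ≤ 0), zero_add]
      _ ≤ (a * (⨆ x : ℝ, ENNReal.ofReal (x * f₁ - ψ x))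
        + b * (⨆ x : ℝ, ENNReal.ofReal (x * f₀ - ψ x))) := by gcongr <;> apply hA
      _ ≤ _ := le_add_self

section
variable {Ω : Type*} [MeasurableSpace Ω] {φ : Ω → ℝ → ℝ}

lemma cont_aux (hconv : ∀ ω, ConvexOn ℝ Set.univ (φ ω)) (ω : Ω) : Continuous (φ ω) :=
  continuousOn_univ.1 ((hconv ω).continuousOn isOpen_univ)

lemma meas_aux (hφmeas : Measurable (Function.uncurry φ)) (x : ℝ) :
    Measurable (fun ω => φ ω x) :=
  hφmeas.comp (measurable_id.prodMk measurable_const)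

lemma posC_meas (hφmeas : Measurable (Function.uncurry φ))
    (hconv : ∀ ω, ConvexOn ℝ Set.univ (φ ω)) {f : Ω → ℝ} (hf : Measurable f) :
    Measurable (posC φ f) := by
  obtain ⟨S, hSc, hS⟩ := TopologicalSpace.exists_countable_dense ℝ
  have : posC φ f = fun ω => ⨆ x : S, ENNReal.ofReal (x * f ω - φ ω x) := by
    ext ω
    have hc := cont_aux hconv ω
    exact (hS.ciSup' (f := fun x : ℝ => ENNReal.ofReal (x * f ω - φ ω x))
      (ENNReal.continuous_ofReal.comp (by fun_prop))).symm
  rw [this]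
  have := hSc.to_subtype
  refine Measurable.iSup fun x => ?_
  have := meas_aux hφmeas (x : ℝ)
  fun_prop

lemma negC_meas (hφmeas : Measurable (Function.uncurry φ))
    (hconv : ∀ ω, ConvexOn ℝ Set.univ (φ ω)) {f : Ω → ℝ} (hf : Measurable f) :
    Measurable (negC φ f) := by
  obtain ⟨S, hSc, hS⟩ := TopologicalSpace.exists_countable_dense ℝ
  have : negC φ f = fun ω => ⨅ x : S, ENNReal.ofReal (φ ω x - x * f ω) := by
    ext ω
    have hc := cont_aux hconv ω
    rw [negC, ofReal_iInf_aux]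
    exact (hS.ciInf' (f := fun x : ℝ => ENNReal.ofReal (φ ω x - x * f ω))
      (ENNReal.continuous_ofReal.comp (by fun_prop))).symm
  rw [this]
  have := hSc.to_subtype
  refine Measurable.iInf fun x => ?_
  have := meas_aux hφmeas (x : ℝ)
  fun_prop

lemma negC_lt (f : Ω → ℝ) (P : Measure Ω)
    (h : (∫⁻ ω, ENNReal.ofReal (max (φ ω 0) 0) ∂P) < ⊤) : ∫⁻ ω, negC φ f ω ∂P < ⊤ := by
  refine lt_of_le_of_lt (lintegral_mono fun ω => ?_) h
  rw [negC, ofReal_iInf_aux]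
  refine (iInf_le _ 0).trans (ENNReal.ofReal_le_ofReal ?_)
  simp

/-- the inequality for finite measures -/
lemma integrated_aux (hφmeas : Measurable (Function.uncurry φ))
    (hconv : ∀ ω, ConvexOn ℝ Set.univ (φ ω)) (Q₁ Q₀ : Measure Ω)
    [IsFiniteMeasure Q₁] [IsFiniteMeasure Q₀] (μ : SignedMeasure Ω) (f₁ f₀ : Ω → ℝ)
    (hf₁ : Measurable f₁) (hf₀ : Measurable f₀)
    (hi₁ : Integrable f₁ Q₁) (hi₀ : Integrable f₀ Q₀)
    (hμ : μ = Q₁.withDensityᵥ f₁ + Q₀.withDensityᵥ f₀) :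
    μ ≪ᵥ (Q₁ + Q₀).toENNRealVectorMeasure ∧
    (∫⁻ ω, posC φ (μ.rnDeriv (Q₁ + Q₀)) ω ∂(Q₁ + Q₀))
      + ((∫⁻ ω, negC φ f₁ ω ∂Q₁) + (∫⁻ ω, negC φ f₀ ω ∂Q₀))
    ≤ (∫⁻ ω, negC φ (μ.rnDeriv (Q₁ + Q₀)) ω ∂(Q₁ + Q₀))
      + ((∫⁻ ω, posC φ f₁ ω ∂Q₁) + (∫⁻ ω, posC φ f₀ ω ∂Q₀)) := by
  set P := Q₁ + Q₀ with hP
  have hac₁ : Q₁ ≪ P := Measure.AbsolutelyContinuous.rfl.add_right _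
  have hac₀ : Q₀ ≪ P := by
    rw [hP, add_comm]; exact Measure.AbsolutelyContinuous.rfl.add_right _
  have hsum : ∀ᵐ ω ∂P, Q₁.rnDeriv P ω + Q₀.rnDeriv P ω = 1 := by
    filter_upwards [Measure.rnDeriv_add Q₁ Q₀ P, Measure.rnDeriv_self P] with ω h1 h2
    rw [← hP] at h1
    rw [← h2, h1]; rfl
  have hj₁ := (integrable_rnDeriv_smul_iff hac₁).2 hi₁
  have hj₀ := (integrable_rnDeriv_smul_iff hac₀).2 hi₀
  have hj : Integrable (fun ω => (Q₁.rnDeriv P ω).toReal • f₁ ω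
      + (Q₀.rnDeriv P ω).toReal • f₀ ω) P := hj₁.add hj₀
  have hμ' : μ = P.withDensityᵥ (fun ω => (Q₁.rnDeriv P ω).toReal • f₁ ω
      + (Q₀.rnDeriv P ω).toReal • f₀ ω) := by
    ext s hs
    rw [hμ, _root_.add_apply, withDensityᵥ_apply hi₁ hs, withDensityᵥ_apply hi₀ hs,
      withDensityᵥ_apply hj hs, integral_add hj₁.integrableOn hj₀.integrableOn,
      setIntegral_rnDeriv_smul hac₁ hs, setIntegral_rnDeriv_smul hac₀ hs]
  have hacμ : μ ≪ᵥ P.toENNRealVectorMeasure := by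
    refine VectorMeasure.AbsolutelyContinuous.mk fun s hs h0 => ?_
    rw [Measure.toENNRealVectorMeasure_apply_measurable hs] at h0
    rw [hμ', withDensityᵥ_apply hj hs]
    exact setIntegral_measure_zero _ h0
  refine ⟨hacμ, ?_⟩
  have hrn : μ.rnDeriv P =ᵐ[P] (fun ω => (Q₁.rnDeriv P ω).toReal • f₁ ω
      + (Q₀.rnDeriv P ω).toReal • f₀ ω) := by
    refine (SignedMeasure.integrable_rnDeriv μ P).ae_eq_of_withDensityᵥ_eq hj ?_
    rw [(SignedMeasure.absolutelyContinuous_iff_withDensityᵥ_rnDeriv_eq μ P).1 hacμ]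
    exact hμ'
  have hm1 := negC_meas hφmeas hconv hf₁
  have hm0 := negC_meas hφmeas hconv hf₀
  have hp1 := posC_meas hφmeas hconv hf₁
  have hp0 := posC_meas hφmeas hconv hf₀
  have hmy := negC_meas hφmeas hconv (SignedMeasure.measurable_rnDeriv μ P)
  have hpy := posC_meas hφmeas hconv (SignedMeasure.measurable_rnDeriv μ P)
  have hr1 := Measure.measurable_rnDeriv Q₁ P
  have hr0 := Measure.measurable_rnDeriv Q₀ P
  rw [← lintegral_rnDeriv_mul hac₁ hm1.aemeasurable, ← lintegral_rnDeriv_mul hac₀ hm0.aemeasurable,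
    ← lintegral_rnDeriv_mul hac₁ hp1.aemeasurable, ← lintegral_rnDeriv_mul hac₀ hp0.aemeasurable,
    ← lintegral_add_left (by fun_prop), ← lintegral_add_left (by fun_prop),
    ← lintegral_add_left (by fun_prop), ← lintegral_add_left (by fun_prop)]
  refine lintegral_mono_ae ?_
  filter_upwards [hsum, hrn] with ω h1 h2
  exact pointwise_aux (φ ω) _ _ _ _ _ h1 h2

end

theorem stmt_10 {Ω : Type*} [MeasurableSpace Ω]
    (φ : Ω → ℝ → ℝ)
    (hφmeas : Measurable (Function.uncurry φ))
    (hconv : ∀ ω, ConvexOn ℝ Set.univ (φ ω))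
    (J : SignedMeasure Ω → Measure Ω → EReal)
    (hJ1 : ∀ (ν : SignedMeasure Ω) (P : Measure Ω),
      ν ≪ᵥ P.toENNRealVectorMeasure →
      J ν P = (∫⁻ ω, ⨆ x : ℝ,
            ENNReal.ofReal (x * ν.rnDeriv P ω - φ ω x) ∂P).toEReal
        - (∫⁻ ω, ENNReal.ofReal (⨅ x : ℝ,
            (φ ω x - x * ν.rnDeriv P ω)) ∂P).toEReal)
    (hJ2 : ∀ (ν : SignedMeasure Ω) (P : Measure Ω),
      ¬ ν ≪ᵥ P.toENNRealVectorMeasure → J ν P = ⊤)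
    (ν₀ ν₁ : SignedMeasure Ω) (P₀ P₁ : Measure Ω)
    [IsProbabilityMeasure P₀] [IsProbabilityMeasure P₁]
    (hφ0 : (∫⁻ ω, ENNReal.ofReal (max (φ ω 0) 0) ∂P₀) < ⊤)
    (hφ1 : (∫⁻ ω, ENNReal.ofReal (max (φ ω 0) 0) ∂P₁) < ⊤)
    (t : ℝ) (ht : t ∈ Set.Icc (0 : ℝ) 1) :
    J (t • ν₁ + (1 - t) • ν₀)
        (ENNReal.ofReal t • P₁ + ENNReal.ofReal (1 - t) • P₀)
      ≤ ((t : ℝ) : EReal) * J ν₁ P₁ + ((1 - t : ℝ) : EReal) * J ν₀ P₀ := by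

  change ∀ (ν : SignedMeasure Ω) (P : Measure Ω), ν ≪ᵥ P.toENNRealVectorMeasure →
      J ν P = (∫⁻ ω, posC φ (ν.rnDeriv P) ω ∂P).toEReal
        - (∫⁻ ω, negC φ (ν.rnDeriv P) ω ∂P).toEReal at hJ1
  obtain ⟨ht0, ht1⟩ := ht
  rcases ht0.eq_or_lt with rfl | ht0
  · simp
  rcases ht1.eq_or_lt with rfl | ht1
  · simp
  have hs0 : 0 < 1 - t := by linarith
  have hbot : ∀ (ν : SignedMeasure Ω) (P : Measure Ω),
      (∫⁻ ω, ENNReal.ofReal (max (φ ω 0) 0) ∂P) < ⊤ → J ν P ≠ ⊥ := by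
    intro ν P h
    by_cases hac : ν ≪ᵥ P.toENNRealVectorMeasure
    · rw [hJ1 _ _ hac]
      have := negC_lt (ν.rnDeriv P) P h
      lift (∫⁻ ω, negC φ (ν.rnDeriv P) ω ∂P) to NNReal using this.ne with n
      induction (∫⁻ ω, posC φ (ν.rnDeriv P) ω ∂P) with
      | top => 
        change (⊤ : EReal) - ((n : ℝ) : EReal) ≠ ⊥
        simp
      | coe m =>
        change ((m : ℝ) : EReal) - ((n : ℝ) : EReal) ≠ ⊥
        exact_mod_cast EReal.coe_ne_bot _
    · rw [hJ2 _ _ hac]; simp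
  have hmulbot : ∀ (s : ℝ) (x : EReal), 0 < s → x ≠ ⊥ → (s : EReal) * x ≠ ⊥ := by
    intro s x hs hx
    induction x with
    | bot => exact absurd rfl hx
    | top => rw [EReal.coe_mul_top_of_pos hs]; simp
    | coe r => exact_mod_cast EReal.coe_ne_bot _
  have hb1 := hmulbot t _ ht0 (hbot ν₁ P₁ hφ1)
  have hb0 := hmulbot (1 - t) _ hs0 (hbot ν₀ P₀ hφ0)
  by_cases hT1 : J ν₁ P₁ = ⊤
  · rw [hT1, EReal.coe_mul_top_of_pos ht0, EReal.top_add_of_ne_bot hb0]; exact le_top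
  by_cases hT0 : J ν₀ P₀ = ⊤
  · rw [hT0, EReal.coe_mul_top_of_pos hs0, EReal.add_top_of_ne_bot hb1]; exact le_top
  have hac1 : ν₁ ≪ᵥ P₁.toENNRealVectorMeasure := by
    by_contra h; exact hT1 (hJ2 _ _ h)
  have hac0 : ν₀ ≪ᵥ P₀.toENNRealVectorMeasure := by
    by_contra h; exact hT0 (hJ2 _ _ h)
  have hQ1 : IsFiniteMeasure (ENNReal.ofReal t • P₁) := Measure.smul_finite _ ENNReal.ofReal_ne_top
  have hQ0 : IsFiniteMeasure (ENNReal.ofReal (1 - t) • P₀) :=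
    Measure.smul_finite _ ENNReal.ofReal_ne_top
  have hi1 := SignedMeasure.integrable_rnDeriv ν₁ P₁
  have hi0 := SignedMeasure.integrable_rnDeriv ν₀ P₀
  have hk1 := hi1.smul_measure (c := ENNReal.ofReal t) ENNReal.ofReal_ne_top
  have hk0 := hi0.smul_measure (c := ENNReal.ofReal (1 - t)) ENNReal.ofReal_ne_top
  have hμ : t • ν₁ + (1 - t) • ν₀ =
      (ENNReal.ofReal t • P₁).withDensityᵥ (ν₁.rnDeriv P₁)
      + (ENNReal.ofReal (1 - t) • P₀).withDensityᵥ (ν₀.rnDeriv P₀) := by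
    have e1 := (SignedMeasure.absolutelyContinuous_iff_withDensityᵥ_rnDeriv_eq ν₁ P₁).1 hac1
    have e0 := (SignedMeasure.absolutelyContinuous_iff_withDensityᵥ_rnDeriv_eq ν₀ P₀).1 hac0
    ext s hs
    rw [_root_.add_apply, _root_.add_apply, withDensityᵥ_apply hk1 hs,
      withDensityᵥ_apply hk0 hs, Measure.restrict_smul, Measure.restrict_smul,
      integral_smul_measure, integral_smul_measure, ENNReal.toReal_ofReal ht0.le,
      ENNReal.toReal_ofReal hs0.le, ← withDensityᵥ_apply hi1 hs, ← withDensityᵥ_apply hi0 hs,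
      e1, e0]
    rfl
  obtain ⟨hac, hineq⟩ := integrated_aux hφmeas hconv (ENNReal.ofReal t • P₁)
    (ENNReal.ofReal (1 - t) • P₀) (t • ν₁ + (1 - t) • ν₀) _ _
    (SignedMeasure.measurable_rnDeriv ν₁ P₁) (SignedMeasure.measurable_rnDeriv ν₀ P₀) hk1 hk0 hμ
  have hφP : (∫⁻ ω, ENNReal.ofReal (max (φ ω 0) 0)
      ∂(ENNReal.ofReal t • P₁ + ENNReal.ofReal (1 - t) • P₀)) < ⊤ := by
    rw [lintegral_add_measure, lintegral_smul_measure, lintegral_smul_measure]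
    exact ENNReal.add_lt_top.2 ⟨ENNReal.mul_lt_top ENNReal.ofReal_lt_top hφ1,
      ENNReal.mul_lt_top ENNReal.ofReal_lt_top hφ0⟩
  have hN := negC_lt ((t • ν₁ + (1 - t) • ν₀).rnDeriv
    (ENNReal.ofReal t • P₁ + ENNReal.ofReal (1 - t) • P₀)) _ hφP
  have hN1 := negC_lt (ν₁.rnDeriv P₁) _ hφ1
  have hN0 := negC_lt (ν₀.rnDeriv P₀) _ hφ0
  rw [hJ1 _ _ hac1] at hT1 ⊢
  rw [hJ1 _ _ hac0] at hT0 ⊢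
  rw [hJ1 _ _ hac]
  simp only [lintegral_smul_measure] at hineq
  generalize (∫⁻ ω, negC φ (ν₁.rnDeriv P₁) ω ∂P₁) = n1 at *
  generalize (∫⁻ ω, negC φ (ν₀.rnDeriv P₀) ω ∂P₀) = n0 at *
  generalize (∫⁻ ω, posC φ (ν₁.rnDeriv P₁) ω ∂P₁) = m1 at *
  generalize (∫⁻ ω, posC φ (ν₀.rnDeriv P₀) ω ∂P₀) = m0 at *
  generalize (∫⁻ ω, negC φ ((t • ν₁ + (1 - t) • ν₀).rnDeriv
    (ENNReal.ofReal t • P₁ + ENNReal.ofReal (1 - t) • P₀)) ω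
    ∂(ENNReal.ofReal t • P₁ + ENNReal.ofReal (1 - t) • P₀)) = n at *
  generalize (∫⁻ ω, posC φ ((t • ν₁ + (1 - t) • ν₀).rnDeriv
    (ENNReal.ofReal t • P₁ + ENNReal.ofReal (1 - t) • P₀)) ω
    ∂(ENNReal.ofReal t • P₁ + ENNReal.ofReal (1 - t) • P₀)) = m at *
  lift n1 to NNReal using hN1.ne
  lift n0 to NNReal using hN0.ne
  lift n to NNReal using hN.ne
  have hm1 : m1 ≠ ⊤ := by
    rintro rfl
    exact hT1 (EReal.top_sub_coe (n1 : ℝ))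
  have hm0 : m0 ≠ ⊤ := by
    rintro rfl
    exact hT0 (EReal.top_sub_coe (n0 : ℝ))
  lift m1 to NNReal using hm1
  lift m0 to NNReal using hm0
  lift t to NNReal using ht0.le
  obtain ⟨s, hs⟩ : ∃ s : NNReal, (s : ℝ) = 1 - (t : ℝ) := ⟨⟨1 - t, hs0.le⟩, rfl⟩
  rw [← hs] at hineq ⊢
  simp only [ENNReal.ofReal_coe_nnreal, smul_eq_mul] at hineq
  have hm : m ≠ ⊤ := by
    rintro rfl
    rw [top_add, top_le_iff] at hineq
    exact absurd hineq (by norm_cast)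
  lift m to NNReal using hm
  have h : (m : ℝ) + (t * n1 + s * n0) ≤ n + (t * m1 + s * m0) := by exact_mod_cast hineq
  change ((m : ℝ) : EReal) - ((n : ℝ) : EReal) ≤ ((t : ℝ) : EReal) *
    (((m1 : ℝ) : EReal) - ((n1 : ℝ) : EReal)) + ((s : ℝ) : EReal) *
    (((m0 : ℝ) : EReal) - ((n0 : ℝ) : EReal))
  have h' : (m : ℝ) - n ≤ t * (m1 - n1) + s * (m0 - n0) := by linarith
  exact_mod_cast h'
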